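/- Let η₀, η₁, η₂ > 0, let β(s) := η₀·exp(−η₁·s^{η₂}) for s > 0, and let a > 0. Then there exist constants C > 0 and v₀ ∈ (0, min(1,a)) such that K*(v) ≥ C·v·(log(1/v))^{−1/η₂} for all v ∈ (0, v₀]; moreover there exists C' > 0 such that for all n ∈ ℕ, F_a⁻¹(n) ≤ C'·exp(−(C·((1+η₂)/η₂)·n)^{η₂/(1+η₂)}). -/

import Mathlib

open MeasureTheory Filter
open scoped ENNReal

/-- `K(u) := u·β(1/u)` for `u ≠ 0`, with `K(0) := 0`. -/
noncomputable def Kfun (β : ℝ → ℝ) (u : ℝ) : ℝ := if u = 0 then 0 else u * β u⁻¹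

/-- The convex conjugate `K*(v) := sup_{u ≥ 0} (u·v − K(u))`, valued in `[0,∞]`. -/
noncomputable def Kstar (β : ℝ → ℝ) (v : ℝ) : ℝ≥0∞ :=
  ⨆ u ∈ Set.Ici (0 : ℝ), ENNReal.ofReal (u * v - Kfun β u)

/-- `F_a(x) := ∫_x^a dv / K*(v)`. -/
noncomputable def Fa (β : ℝ → ℝ) (a x : ℝ) : ℝ :=
  (∫⁻ v in Set.Ioc x a, (Kstar β v)⁻¹).toReal

theorem Kstar_mono (β : ℝ → ℝ) : Monotone (Kstar β) := fun _ _ h =>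
  iSup₂_mono fun _ hu =>
    ENNReal.ofReal_le_ofReal (sub_le_sub_right (mul_le_mul_of_nonneg_left h hu) _)

/-- Testing the supremum at `u = (η₁ / (2 log (1/v)))^{1/η₂}`, where `β (1/u) = η₀ v²`. -/
theorem ofReal_le_Kstar_exp_decay {η₀ η₁ η₂ v : ℝ} (h₁ : 0 < η₁) (h₂ : 0 < η₂)
    (hv : 0 < v) (hv1 : v < 1) (hv2 : 2 * η₀ * v ≤ 1) :
    ENNReal.ofReal ((η₁ / 2) ^ (1 / η₂) / 2 * v * Real.log (1 / v) ^ (-1 / η₂)) ≤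
      Kstar (fun s : ℝ => η₀ * Real.exp (-η₁ * s ^ η₂)) v := by
  have hL : 0 < Real.log (1 / v) := Real.log_pos (by rwa [lt_div_iff₀ hv, one_mul])
  set L := Real.log (1 / v) with hLdef
  have hu : 0 < (η₁ / 2 / L) ^ (1 / η₂) := by positivity
  have hpow : ((η₁ / 2 / L) ^ (1 / η₂))⁻¹ ^ η₂ = (η₁ / 2 / L)⁻¹ := by
    rw [Real.inv_rpow hu.le, ← Real.rpow_mul (by positivity), one_div_mul_cancel h₂.ne',
      Real.rpow_one]
  have hexp : Real.exp (-η₁ * ((η₁ / 2 / L) ^ (1 / η₂))⁻¹ ^ η₂) = v * v := by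
    have : -η₁ * (η₁ / 2 / L)⁻¹ = Real.log v + Real.log v := by
      have : L = -Real.log v := by rw [hLdef, one_div, Real.log_inv]
      rw [inv_div, ← mul_div_assoc, div_eq_iff (by positivity), this]
      ring
    rw [hpow, this, Real.exp_add, Real.exp_log hv]
  have hsplit : (η₁ / 2 / L) ^ (1 / η₂) = (η₁ / 2) ^ (1 / η₂) * L ^ (-1 / η₂) := by
    rw [Real.div_rpow (by positivity) hL.le, neg_div, Real.rpow_neg hL.le, div_eq_mul_inv]
  refine le_trans (ENNReal.ofReal_le_ofReal ?_)
    (le_iSup₂_of_le ((η₁ / 2 / L) ^ (1 / η₂)) hu.le le_rfl)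
  rw [Kfun, if_neg hu.ne', hexp]
  have : (η₁ / 2) ^ (1 / η₂) / 2 * v * L ^ (-1 / η₂) = (η₁ / 2 / L) ^ (1 / η₂) * (v / 2) := by
    rw [hsplit]; ring
  rw [this, ← mul_sub]
  exact mul_le_mul_of_nonneg_left (by nlinarith) hu.le

theorem hasDerivAt_neg_log_rpow {p v : ℝ} (hp : p + 1 ≠ 0) (hv : 0 < v) (hv1 : v < 1) :
    HasDerivAt (fun t => -((-Real.log t) ^ (p + 1) / (p + 1))) ((-Real.log v) ^ p / v) v := by
  have hL : 0 < -Real.log v := neg_pos.2 (Real.log_neg hv hv1)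
  have h := (((Real.hasDerivAt_log hv.ne').neg.rpow_const (p := p + 1)
    (Or.inl hL.ne')).div_const (p + 1)).neg
  refine h.congr_deriv ?_
  rw [add_sub_cancel_right, Pi.neg_apply]
  field_simp

theorem lintegral_neg_log_rpow_div_le {p x w : ℝ} (hp : 0 ≤ p) (hx : 0 < x) (hxw : x ≤ w)
    (hw : w < 1) :
    ∫⁻ v in Set.Ioc x w, ENNReal.ofReal ((-Real.log v) ^ p / v) ≤
      ENNReal.ofReal ((-Real.log x) ^ (p + 1) / (p + 1)) := by
  have hpos : ∀ v ∈ Set.Icc x w, 0 < v ∧ v < 1 := fun v hv =>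
    ⟨hx.trans_le hv.1, hv.2.trans_lt hw⟩
  have hcont : ContinuousOn (fun v => (-Real.log v) ^ p / v) (Set.Icc x w) := fun v hv =>
    ((((Real.continuousAt_log (hpos v hv).1.ne').neg).rpow_const (Or.inr hp)).div
      continuousAt_id (hpos v hv).1.ne').continuousWithinAt
  have hlog : ∀ v ∈ Set.Icc x w, 0 ≤ -Real.log v := fun v hv =>
    neg_nonneg.2 (Real.log_nonpos (hpos v hv).1.le (hpos v hv).2.le)
  rw [← ofReal_integral_eq_lintegral_ofReal
    (hcont.integrableOn_Icc.mono_set Set.Ioc_subset_Icc_self)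
    ((ae_restrict_mem measurableSet_Ioc).mono fun v hv =>
      div_nonneg (Real.rpow_nonneg (hlog v (Set.Ioc_subset_Icc_self hv)) p)
        (hpos v (Set.Ioc_subset_Icc_self hv)).1.le),
    ← intervalIntegral.integral_of_le hxw,
    intervalIntegral.integral_eq_sub_of_hasDerivAt (f := fun t =>
      -((-Real.log t) ^ (p + 1) / (p + 1)))]
  · refine ENNReal.ofReal_le_ofReal ?_
    have := Real.rpow_nonneg (hlog w (Set.right_mem_Icc.2 hxw)) (p + 1)
    have : 0 ≤ (-Real.log w) ^ (p + 1) / (p + 1) := by positivity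
    linarith
  · intro v hv
    rw [Set.uIcc_of_le hxw] at hv
    exact hasDerivAt_neg_log_rpow (by positivity) (hpos v hv).1 (hpos v hv).2
  · exact ContinuousOn.intervalIntegrable (by rwa [Set.uIcc_of_le hxw])

/-- A lower bound `C v (log (1/v))^{-p} ≤ K*(v)` near `0` bounds `F_a` from above there. -/
theorem Fa_le_of_le_Kstar {β : ℝ → ℝ} {C p w a x : ℝ} (hC : 0 < C) (hp : 0 ≤ p)
    (hw : w < 1)
    (hK : ∀ v ∈ Set.Ioc (0 : ℝ) w,
      ENNReal.ofReal (C * v * Real.log (1 / v) ^ (-p)) ≤ Kstar β v)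
    (hfin : ∫⁻ v in Set.Ioc w a, (Kstar β v)⁻¹ ≠ ∞) (hx : 0 < x) (hxw : x ≤ w) :
    Fa β a x ≤ C⁻¹ * ((-Real.log x) ^ (p + 1) / (p + 1)) + Fa β a w := by
  have hlogx : 0 ≤ -Real.log x := neg_nonneg.2 (Real.log_nonpos hx.le (hxw.trans hw.le))
  have hnear : ∫⁻ v in Set.Ioc x w, (Kstar β v)⁻¹ ≤
      ENNReal.ofReal (C⁻¹ * ((-Real.log x) ^ (p + 1) / (p + 1))) := by
    calc ∫⁻ v in Set.Ioc x w, (Kstar β v)⁻¹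
        ≤ ∫⁻ v in Set.Ioc x w, ENNReal.ofReal C⁻¹ * ENNReal.ofReal ((-Real.log v) ^ p / v) := by
          refine setLIntegral_mono' measurableSet_Ioc fun v hv => ?_
          have hv0 : 0 < v := hx.trans hv.1
          have hL : 0 < -Real.log v := neg_pos.2 (Real.log_neg hv0 (hv.2.trans_lt hw))
          refine (ENNReal.inv_le_inv.2 (hK v ⟨hv0, hv.2⟩)).trans_eq ?_
          rw [one_div, Real.log_inv, ← ENNReal.ofReal_inv_of_pos (by positivity),
            ← ENNReal.ofReal_mul (by positivity), Real.rpow_neg hL.le]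
          congr 1
          field_simp
      _ = ENNReal.ofReal C⁻¹ * ∫⁻ v in Set.Ioc x w, ENNReal.ofReal ((-Real.log v) ^ p / v) :=
          lintegral_const_mul' _ _ ENNReal.ofReal_ne_top
      _ ≤ _ := by
          rw [ENNReal.ofReal_mul (by positivity)]
          gcongr
          exact lintegral_neg_log_rpow_div_le hp hx hxw hw
  have htot : ∫⁻ v in Set.Ioc x a, (Kstar β v)⁻¹ ≤
      ENNReal.ofReal (C⁻¹ * ((-Real.log x) ^ (p + 1) / (p + 1))) +
        ∫⁻ v in Set.Ioc w a, (Kstar β v)⁻¹ :=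
    ((lintegral_mono_set Set.Ioc_subset_Ioc_union_Ioc).trans (lintegral_union_le _ _ _)).trans
      (add_le_add_left hnear _)
  have := ENNReal.toReal_mono (ENNReal.add_ne_top.2 ⟨ENNReal.ofReal_ne_top, hfin⟩) htot
  rwa [ENNReal.toReal_add ENNReal.ofReal_ne_top hfin,
    ENNReal.toReal_ofReal (by positivity)] at this

theorem lintegral_inv_Kstar_ne_top {β : ℝ → ℝ} {w : ℝ} (hw : Kstar β w ≠ 0) (a : ℝ) :
    ∫⁻ v in Set.Ioc w a, (Kstar β v)⁻¹ ≠ ∞ := by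
  refine ((setLIntegral_mono' measurableSet_Ioc fun v hv =>
    ENNReal.inv_le_inv.2 (Kstar_mono β hv.1.le)).trans_lt ?_).ne
  rw [setLIntegral_const, Real.volume_Ioc]
  exact ENNReal.mul_lt_top (ENNReal.inv_lt_top.2 (pos_iff_ne_zero.2 hw)) ENNReal.ofReal_lt_top

theorem Fa_le_Fa {β : ℝ → ℝ} {w a x : ℝ}
    (hfin : ∫⁻ v in Set.Ioc w a, (Kstar β v)⁻¹ ≠ ∞) (hwx : w ≤ x) :
    Fa β a x ≤ Fa β a w :=
  ENNReal.toReal_mono hfin (lintegral_mono_set (Set.Ioc_subset_Ioc_left hwx))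

/-- Lemma (exponentially decaying `β`): for `β(s) = η₀ exp(−η₁ s^{η₂})`, there are `C > 0` and
`v₀ ∈ (0, 1 ∧ a)` with `K*(v) ≥ C v (log(1/v))^{-1/η₂}` on `(0, v₀]`, and `C' > 0` with
`F_a⁻¹(n) ≤ C' exp(−(C (1+η₂)/η₂ · n)^{η₂/(1+η₂)})` for all `n ∈ ℕ`. -/
theorem stmt5 (η₀ η₁ η₂ : ℝ) (h₀ : 0 < η₀) (h₁ : 0 < η₁) (h₂ : 0 < η₂)
    (β : ℝ → ℝ) (hβ : β = fun s : ℝ => η₀ * Real.exp (-η₁ * s ^ η₂))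
    (a : ℝ) (ha : 0 < a)
    (Finv : ℝ → ℝ)
    (hFinv : ∀ x : ℝ, 0 < x → Finv x ∈ Set.Ioo 0 a ∧ Fa β a (Finv x) = x) :
    ∃ C : ℝ, 0 < C ∧
      (∃ v₀ : ℝ, v₀ ∈ Set.Ioo 0 (min 1 a) ∧
        ∀ v ∈ Set.Ioc (0 : ℝ) v₀,
          ENNReal.ofReal (C * v * Real.log (1 / v) ^ (-1 / η₂)) ≤ Kstar β v) ∧
      ∃ C' : ℝ, 0 < C' ∧
        ∀ n : ℕ, 1 ≤ n →
          Finv (n : ℝ) ≤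
            C' * Real.exp (-(C * ((1 + η₂) / η₂) * (n : ℝ)) ^ (η₂ / (1 + η₂))) := by
  subst hβ
  have hCpos : 0 < (η₁ / 2) ^ (1 / η₂) / 2 := by positivity
  refine ⟨(η₁ / 2) ^ (1 / η₂) / 2, hCpos, ?_⟩
  have hm : 0 < min (min 1 a) (1 / (2 * η₀)) := by positivity
  set w := min (min 1 a) (1 / (2 * η₀)) / 2
  have hw0 : 0 < w := half_pos hm
  have hwm : w < min 1 a := (half_lt_self hm).trans_le (min_le_left _ _)
  have hw1 : w < 1 := hwm.trans_le (min_le_left _ _)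
  have hwη : w ≤ 1 / (2 * η₀) := (half_lt_self hm).le.trans (min_le_right _ _)
  have hK : ∀ v ∈ Set.Ioc (0 : ℝ) w,
      ENNReal.ofReal ((η₁ / 2) ^ (1 / η₂) / 2 * v * Real.log (1 / v) ^ (-1 / η₂)) ≤
        Kstar (fun s : ℝ => η₀ * Real.exp (-η₁ * s ^ η₂)) v := fun v hv => by
    refine ofReal_le_Kstar_exp_decay h₁ h₂ hv.1 (hv.2.trans_lt hw1) ?_
    have := hv.2.trans hwη
    rwa [le_div_iff₀ (by positivity), mul_comm] at this
  refine ⟨⟨w, ⟨hw0, hwm⟩, hK⟩, ?_⟩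
  generalize (η₁ / 2) ^ (1 / η₂) / 2 = C at hK hCpos
  generalize (fun s : ℝ => η₀ * Real.exp (-η₁ * s ^ η₂)) = β at hK hFinv
  have hKw : Kstar β w ≠ 0 := by
    refine ((ENNReal.ofReal_pos.2 ?_).trans_le (hK w ⟨hw0, le_rfl⟩)).ne'
    have : 0 < Real.log (1 / w) := Real.log_pos (by rwa [lt_div_iff₀ hw0, one_mul])
    positivity
  have hfin := lintegral_inv_Kstar_ne_top hKw a
  have hA : 0 ≤ Fa β a w := ENNReal.toReal_nonneg
  set r := η₂ / (1 + η₂) with hr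
  have hr0 : 0 < r := by positivity
  have hr1 : r ≤ 1 := (div_le_one (by positivity)).2 (by linarith)
  have hq : 1 / η₂ + 1 = (1 + η₂) / η₂ := by field_simp
  have hq0 : 0 < (1 + η₂) / η₂ := by positivity
  have hqr : (1 + η₂) / η₂ * r = 1 := by rw [hr]; field_simp
  set q := (1 + η₂) / η₂
  set D := C * q * Fa β a w with hD
  have hD0 : 0 ≤ D := by positivity
  refine ⟨max 1 a * Real.exp (D ^ r), by positivity, fun n hn => ?_⟩
  obtain ⟨⟨hx0, hxa⟩, hFx⟩ := hFinv n (by exact_mod_cast hn)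
  generalize Finv n = x at hx0 hxa hFx
  rw [mul_assoc, ← Real.exp_add]
  rcases le_total x w with hxw | hwx
  · have hL : 0 ≤ -Real.log x := neg_nonneg.2 (Real.log_nonpos hx0.le (hxw.trans hw1.le))
    have hF := Fa_le_of_le_Kstar (p := 1 / η₂) hCpos (by positivity) hw1
      (by simpa only [neg_div] using hK) hfin hx0 hxw
    rw [hFx, hq] at hF
    have hn' : C * q * n ≤ (-Real.log x) ^ q + D := by
      calc C * q * n ≤ C * q * (C⁻¹ * ((-Real.log x) ^ q / q) + Fa β a w) := by gcongr
        _ = _ := by rw [hD]; field_simp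
    have hroot : (C * q * n) ^ r ≤ -Real.log x + D ^ r := by
      calc (C * q * n) ^ r ≤ ((-Real.log x) ^ q + D) ^ r := by gcongr
        _ ≤ ((-Real.log x) ^ q) ^ r + D ^ r :=
          Real.rpow_add_le_add_rpow (by positivity) hD0 hr0.le hr1
        _ = _ := by rw [← Real.rpow_mul hL, hqr, Real.rpow_one]
    calc x = Real.exp (Real.log x) := (Real.exp_log hx0).symm
      _ ≤ Real.exp (D ^ r + -(C * q * n) ^ r) := Real.exp_le_exp.2 (by linarith)
      _ ≤ _ := le_mul_of_one_le_left (Real.exp_nonneg _) (le_max_left _ _)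
  · have hn' : C * q * n ≤ D := by
      rw [hD, ← hFx]
      exact mul_le_mul_of_nonneg_left (Fa_le_Fa hfin hwx) (by positivity)
    have hroot : (C * q * n) ^ r ≤ D ^ r := by gcongr
    calc x ≤ max 1 a := hxa.le.trans (le_max_right _ _)
      _ ≤ _ := le_mul_of_one_le_right (by positivity)
        (Real.one_le_exp (by linarith))
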